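/- arXiv:1212.0185 — 3 statements merged into one kernel-verified Lean document; each statement's English description precedes it below -/
import Mathlib

section
/- Let R be a commutative unital ring in which 2 is invertible, let A = R[X]/(X² − 1) be the Lee algebra with e₊ = (1 + X)/2 and e₋ = (1 − X)/2, let m : A ⊗_R A → A be the multiplication map, and let Δ : A → A ⊗_R A be the R-linear Lee comultiplication determined by Δ(1) = 1⊗X + X⊗1 and Δ(X) = 1⊗1 + X⊗X. Then Δ(e₊) = 2·(e₊ ⊗ e₊) and Δ(e₋) = −2·(e₋ ⊗ e₋), and m(e₊ ⊗ e₊) = e₊ and m(e₋ ⊗ e₋) = e₋. Consequently m restricts to an R-module isomorphism from the submodule R·(e₊ ⊗ e₊) of A ⊗_R A onto R·e₊ with inverse (1/2)·Δ, and to an R-module isomorphism from R·(e₋ ⊗ e₋) onto R·e₋ with inverse −(1/2)·Δ. -/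
open Polynomial

noncomputable section

/-- The Lee algebra `A = R[X]/(X² - 1)`. -/
abbrev LeeAlg (R : Type*) [CommRing R] : Type _ :=
  Polynomial R ⧸ Ideal.span ({X ^ 2 - 1} : Set (Polynomial R))

/-- The image of the variable `X` in the Lee algebra. -/
def LeeX (R : Type*) [CommRing R] : LeeAlg R :=
  Ideal.Quotient.mk _ X

/-- The 'down' idempotent `e₊ = (1 + X)/2` of the Lee algebra. -/
def LeeEplus (R : Type*) [CommRing R] [Invertible (2 : R)] : LeeAlg R :=
  (⅟(2 : R)) • (1 + LeeX R)

/-- The 'up' idempotent `e₋ = (1 - X)/2` of the Lee algebra. -/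
def LeeEminus (R : Type*) [CommRing R] [Invertible (2 : R)] : LeeAlg R :=
  (⅟(2 : R)) • (1 - LeeX R)

lemma LeeX_mul_self (R : Type*) [CommRing R] : LeeX R * LeeX R = 1 := by
  have h : Ideal.Quotient.mk (Ideal.span ({X ^ 2 - 1} : Set (Polynomial R))) (X ^ 2 - 1) = 0 :=
    Ideal.Quotient.eq_zero_iff_mem.mpr (Ideal.mem_span_singleton_self _)
  rw [map_sub, map_pow, map_one, sub_eq_zero] at h
  exact (pow_two _).symm.trans h

lemma LeeEplus_mul_self (R : Type*) [CommRing R] [Invertible (2 : R)] :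
    LeeEplus R * LeeEplus R = LeeEplus R := by
  have h : (1 + LeeX R) * (1 + LeeX R) = (2 : R) • (1 + LeeX R) := by
    rw [two_smul]
    linear_combination LeeX_mul_self R
  rw [LeeEplus, smul_mul_smul_comm, h, smul_smul, mul_assoc, invOf_mul_self, mul_one]

lemma LeeEminus_mul_self (R : Type*) [CommRing R] [Invertible (2 : R)] :
    LeeEminus R * LeeEminus R = LeeEminus R := by
  have h : (1 - LeeX R) * (1 - LeeX R) = (2 : R) • (1 - LeeX R) := by
    rw [two_smul]
    linear_combination LeeX_mul_self R
  rw [LeeEminus, smul_mul_smul_comm, h, smul_smul, mul_assoc, invOf_mul_self, mul_one]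

open TensorProduct

section Idempotent

variable {R A : Type*} [CommRing R] [CommRing A] [Algebra R A]

lemma map_mul'_span_tmul_self {e : A} (he : e * e = e) :
    Submodule.map (LinearMap.mul' R A) (Submodule.span R {e ⊗ₜ[R] e}) = Submodule.span R {e} := by
  rw [Submodule.map_span, Set.image_singleton, LinearMap.mul'_apply, he]

lemma smul_comul_mul'_of_mem_span {e : A} (he : e * e = e) {Δ : A →ₗ[R] A ⊗[R] A} {u v : R}
    (hvu : v * u = 1) (hΔ : Δ e = u • (e ⊗ₜ[R] e)) {y : A ⊗[R] A}
    (hy : y ∈ Submodule.span R {e ⊗ₜ[R] e}) : v • Δ (LinearMap.mul' R A y) = y := by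
  obtain ⟨r, rfl⟩ := Submodule.mem_span_singleton.mp hy
  rw [map_smul, LinearMap.mul'_apply, he, map_smul, hΔ, smul_comm r u, smul_smul, hvu, one_smul]

lemma mul'_smul_comul_of_mem_span {e : A} (he : e * e = e) {Δ : A →ₗ[R] A ⊗[R] A} {u v : R}
    (hvu : v * u = 1) (hΔ : Δ e = u • (e ⊗ₜ[R] e)) {z : A}
    (hz : z ∈ Submodule.span R {e}) : LinearMap.mul' R A (v • Δ z) = z := by
  obtain ⟨r, rfl⟩ := Submodule.mem_span_singleton.mp hz
  rw [map_smul Δ, hΔ, smul_comm r u, smul_smul, hvu, one_smul, map_smul, LinearMap.mul'_apply, he]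

end Idempotent

/-- The Lee comultiplication sends `e₊` to `2·(e₊ ⊗ e₊)` and `e₋` to `-2·(e₋ ⊗ e₋)`, the
multiplication sends `e₊ ⊗ e₊` to `e₊` and `e₋ ⊗ e₋` to `e₋`, and consequently the
multiplication restricts to isomorphisms `R·(e₊ ⊗ e₊) ≅ R·e₊` with inverse `(1/2)·Δ` and
`R·(e₋ ⊗ e₋) ≅ R·e₋` with inverse `-(1/2)·Δ`. -/
theorem lee_saddles_invertible_on_idempotents
    (R : Type*) [CommRing R] [Invertible (2 : R)]
    (Δ : LeeAlg R →ₗ[R] LeeAlg R ⊗[R] LeeAlg R)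
    (hΔ1 : Δ 1 = 1 ⊗ₜ[R] LeeX R + LeeX R ⊗ₜ[R] 1)
    (hΔX : Δ (LeeX R) = 1 ⊗ₜ[R] 1 + LeeX R ⊗ₜ[R] LeeX R) :
    Δ (LeeEplus R) = (2 : R) • (LeeEplus R ⊗ₜ[R] LeeEplus R) ∧
    Δ (LeeEminus R) = -((2 : R) • (LeeEminus R ⊗ₜ[R] LeeEminus R)) ∧
    LinearMap.mul' R (LeeAlg R) (LeeEplus R ⊗ₜ[R] LeeEplus R) = LeeEplus R ∧
    LinearMap.mul' R (LeeAlg R) (LeeEminus R ⊗ₜ[R] LeeEminus R) = LeeEminus R ∧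
    Submodule.map (LinearMap.mul' R (LeeAlg R))
        (Submodule.span R ({LeeEplus R ⊗ₜ[R] LeeEplus R} : Set (LeeAlg R ⊗[R] LeeAlg R)))
      = Submodule.span R ({LeeEplus R} : Set (LeeAlg R)) ∧
    (∀ y ∈ Submodule.span R ({LeeEplus R ⊗ₜ[R] LeeEplus R} : Set (LeeAlg R ⊗[R] LeeAlg R)),
      (⅟(2 : R)) • Δ (LinearMap.mul' R (LeeAlg R) y) = y) ∧
    (∀ z ∈ Submodule.span R ({LeeEplus R} : Set (LeeAlg R)),
      LinearMap.mul' R (LeeAlg R) ((⅟(2 : R)) • Δ z) = z) ∧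
    Submodule.map (LinearMap.mul' R (LeeAlg R))
        (Submodule.span R ({LeeEminus R ⊗ₜ[R] LeeEminus R} : Set (LeeAlg R ⊗[R] LeeAlg R)))
      = Submodule.span R ({LeeEminus R} : Set (LeeAlg R)) ∧
    (∀ y ∈ Submodule.span R ({LeeEminus R ⊗ₜ[R] LeeEminus R} : Set (LeeAlg R ⊗[R] LeeAlg R)),
      -((⅟(2 : R)) • Δ (LinearMap.mul' R (LeeAlg R) y)) = y) ∧
    (∀ z ∈ Submodule.span R ({LeeEminus R} : Set (LeeAlg R)),
      LinearMap.mul' R (LeeAlg R) (-((⅟(2 : R)) • Δ z)) = z) := by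
  have hp : Δ (LeeEplus R) = (2 : R) • (LeeEplus R ⊗ₜ[R] LeeEplus R) := by
    simp only [LeeEplus, map_smul, map_add, hΔ1, hΔX, smul_tmul_smul]
    rw [smul_smul, ← mul_assoc, mul_invOf_self, one_mul]
    simp only [add_tmul, tmul_add]
    congr 1
    abel
  have hm : Δ (LeeEminus R) = (-2 : R) • (LeeEminus R ⊗ₜ[R] LeeEminus R) := by
    simp only [LeeEminus, map_smul, map_sub, hΔ1, hΔX, smul_tmul_smul]
    rw [smul_smul, ← mul_assoc, neg_mul, mul_invOf_self, neg_mul, one_mul, neg_smul, ← smul_neg]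
    simp only [sub_tmul, tmul_sub]
    congr 1
    abel
  have hep := LeeEplus_mul_self R
  have hem := LeeEminus_mul_self R
  have hu : ⅟(2 : R) * 2 = 1 := invOf_mul_self _
  have hv : -⅟(2 : R) * -2 = 1 := by rw [neg_mul_neg, hu]
  refine ⟨hp, hm.trans (neg_smul (2 : R) (LeeEminus R ⊗ₜ[R] LeeEminus R)), by rw [LinearMap.mul'_apply, hep],
    by rw [LinearMap.mul'_apply, hem], map_mul'_span_tmul_self hep,
    fun y hy => smul_comul_mul'_of_mem_span hep hu hp hy,
    fun z hz => mul'_smul_comul_of_mem_span hep hu hp hz, map_mul'_span_tmul_self hem,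
    fun y hy => ?_, fun z hz => ?_⟩
  · exact (neg_smul _ _).symm.trans (smul_comul_mul'_of_mem_span hem hv hm hy)
  · exact (congrArg _ (neg_smul _ _).symm).trans (mul'_smul_comul_of_mem_span hem hv hm hz)

end
end

section
/- Let R be a commutative unital ring in which 2 is invertible, let A = R[X]/(X² − 1) be the Lee algebra, let m : A ⊗_R A → A be the multiplication map, let Δ : A → A ⊗_R A be the R-linear Lee comultiplication determined by Δ(1) = 1⊗X + X⊗1 and Δ(X) = 1⊗1 + X⊗X, and let Φ : A → A be the R-algebra involution with Φ(X) = −X. Then m ∘ (Φ ⊗ Φ) = Φ ∘ m and Δ ∘ Φ = −(Φ ⊗ Φ) ∘ Δ as R-linear maps. -/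
open Polynomial

noncomputable section

open TensorProduct

theorem LeeX_sq (R : Type*) [CommRing R] : LeeX R ^ 2 = 1 := by
  have h : Ideal.Quotient.mk (Ideal.span ({X ^ 2 - 1} : Set (Polynomial R))) (X ^ 2 - 1) = 0 :=
    Ideal.Quotient.eq_zero_iff_mem.mpr (Ideal.mem_span_singleton_self _)
  rw [map_sub, map_pow, map_one, sub_eq_zero] at h
  exact h

/-- Linear maps out of the Lee algebra are determined by their values at `1` and `X`. -/
theorem LeeAlg.linearMap_ext {R M : Type*} [CommRing R] [AddCommGroup M] [Module R M]
    {f g : LeeAlg R →ₗ[R] M} (h1 : f 1 = g 1) (hX : f (LeeX R) = g (LeeX R)) : f = g := by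
  have hpow (n : ℕ) : f (LeeX R ^ n) = g (LeeX R ^ n) := by
    obtain ⟨k, hk | hk⟩ := n.even_or_odd'
    · have h : LeeX R ^ n = 1 := by rw [hk, pow_mul, LeeX_sq, one_pow]
      rw [h, h1]
    · have h : LeeX R ^ n = LeeX R := by rw [hk, pow_succ, pow_mul, LeeX_sq, one_pow, one_mul]
      rw [h, hX]
  let π := (Ideal.Quotient.mkₐ R (Ideal.span ({X ^ 2 - 1} : Set (Polynomial R)))).toLinearMap
  have hπ (n : ℕ) : π (monomial n 1) = LeeX R ^ n := by
    rw [← X_pow_eq_monomial]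
    exact map_pow (Ideal.Quotient.mkₐ R (Ideal.span ({X ^ 2 - 1} : Set (Polynomial R)))) X n
  have hcomp : f ∘ₗ π = g ∘ₗ π := by
    refine Polynomial.lhom_ext' fun n => LinearMap.ext_ring ?_
    simp only [LinearMap.comp_apply, hπ, hpow]
  refine LinearMap.ext fun x => ?_
  obtain ⟨p, rfl⟩ := Ideal.Quotient.mk_surjective x
  exact LinearMap.congr_fun hcomp p

/-- The Lee multiplication is of type `+1` and the Lee comultiplication is of type `-1` with
respect to the decoration change `Φ`:  `m ∘ (Φ ⊗ Φ) = Φ ∘ m` and `Δ ∘ Φ = -(Φ ⊗ Φ) ∘ Δ`. -/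
theorem lee_mul_comul_decoration_change
    (R : Type*) [CommRing R] [Invertible (2 : R)]
    (Δ : LeeAlg R →ₗ[R] LeeAlg R ⊗[R] LeeAlg R)
    (hΔ1 : Δ 1 = 1 ⊗ₜ[R] LeeX R + LeeX R ⊗ₜ[R] 1)
    (hΔX : Δ (LeeX R) = 1 ⊗ₜ[R] 1 + LeeX R ⊗ₜ[R] LeeX R)
    (σ : LeeAlg R →ₐ[R] LeeAlg R) (hσ : σ (LeeX R) = -LeeX R) :
    (LinearMap.mul' R (LeeAlg R)) ∘ₗ TensorProduct.map σ.toLinearMap σ.toLinearMap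
      = σ.toLinearMap ∘ₗ LinearMap.mul' R (LeeAlg R) ∧
    Δ ∘ₗ σ.toLinearMap = -((TensorProduct.map σ.toLinearMap σ.toLinearMap) ∘ₗ Δ) := by
  constructor
  · refine TensorProduct.ext' fun a b => ?_
    simp only [LinearMap.comp_apply, TensorProduct.map_tmul, LinearMap.mul'_apply,
      AlgHom.toLinearMap_apply, map_mul]
  · apply LeeAlg.linearMap_ext
    · simp only [LinearMap.comp_apply, LinearMap.neg_apply, AlgHom.toLinearMap_apply, map_one,
        hΔ1, map_add, TensorProduct.map_tmul, hσ, TensorProduct.tmul_neg, TensorProduct.neg_tmul,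
        neg_add, neg_neg]
    · simp only [LinearMap.comp_apply, LinearMap.neg_apply, AlgHom.toLinearMap_apply, map_one,
        hσ, map_neg, hΔX, map_add, TensorProduct.map_tmul, TensorProduct.tmul_neg,
        TensorProduct.neg_tmul, neg_neg]

end
end

section
/- Let A = ℚ[X]/(X² − 1) with ℚ-basis {1, X}, and give A ⊗_ℚ A the basis {1⊗1, 1⊗X, X⊗1, X⊗X}. The ℚ-linear map f : A ⊕ A → A ⊗_ℚ A whose matrix with respect to these bases (basis of the source: (1,0), (X,0), (0,1), (0,X)) is the 4×4 matrix with rows (0, 1, 0, −1), (−1, 0, −1, 0), (−1, 0, 1, 0), (0, 1, 0, 1) is a linear isomorphism. Consequently, the chain complex of ℚ-vector spaces 0 → A → A ⊕ A → A ⊗_ℚ A → 0, with the map A → A ⊕ A equal to zero and the map A ⊕ A → A ⊗_ℚ A equal to f, placed in homological degrees 0, 1, 2, has homology isomorphic to ℚ ⊕ ℚ in degree 0 and zero homology in degrees 1 and 2. -/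
open Polynomial

noncomputable section

open TensorProduct

/-- The Lee algebra is free with basis `1, X`. -/
theorem exists_leeAlg_basis (R : Type*) [CommRing R] [Nontrivial R] :
    ∃ b : Module.Basis (Fin 2) R (LeeAlg R), b 0 = 1 ∧ b 1 = LeeX R := by
  have hmonic : (X ^ 2 - 1 : R[X]).Monic := by
    simpa using monic_X_pow_sub_C (1 : R) two_ne_zero
  have hdeg : (X ^ 2 - 1 : R[X]).natDegree = 2 := by
    simpa using natDegree_X_pow_sub_C (n := 2) (r := (1 : R))
  let p := AdjoinRoot.powerBasis' hmonic
  have hdim : p.dim = 2 := hdeg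
  have hb : ∀ i, p.basis.reindex (finCongr hdim) i =
      AdjoinRoot.root (X ^ 2 - 1 : R[X]) ^ (i : ℕ) := by
    intro i
    simp [p]
  exact ⟨p.basis.reindex (finCongr hdim), (hb 0).trans (pow_zero _), (hb 1).trans (pow_one _)⟩

/-- The second differential of the Lee complex of the virtual trefoil, i.e. the ℚ-linear map
`f : A ⊕ A → A ⊗ A` whose matrix with respect to the bases `(1,0), (X,0), (0,1), (0,X)` of
`A ⊕ A` and `1⊗1, 1⊗X, X⊗1, X⊗X` of `A ⊗ A` is
`!![0,1,0,-1; -1,0,-1,0; -1,0,1,0; 0,1,0,1]`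
(the matrix condition is recorded by the images of the four source basis vectors, the images
being given by the columns of the matrix), is a linear isomorphism.  Consequently the complex
`0 → A →⁰ A ⊕ A →ᶠ A ⊗ A → 0` (first differential zero, placed in homological degrees
`0, 1, 2`) has homology `ℚ ⊕ ℚ` in degree `0` (its degree-`0` homology is
`ker (0 : A → A ⊕ A) = A`), and zero homology in degrees `1` (which is `ker f`) and `2`
(which is the cokernel of `f`, i.e. zero iff `range f = ⊤`). -/
theorem lee_complex_virtual_trefoil_homology
    (f : LeeAlg ℚ × LeeAlg ℚ →ₗ[ℚ] LeeAlg ℚ ⊗[ℚ] LeeAlg ℚ)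
    (hf1 : f (1, 0) = -((1 : LeeAlg ℚ) ⊗ₜ[ℚ] LeeX ℚ) - LeeX ℚ ⊗ₜ[ℚ] 1)
    (hf2 : f (LeeX ℚ, 0) = (1 : LeeAlg ℚ) ⊗ₜ[ℚ] 1 + LeeX ℚ ⊗ₜ[ℚ] LeeX ℚ)
    (hf3 : f (0, 1) = -((1 : LeeAlg ℚ) ⊗ₜ[ℚ] LeeX ℚ) + LeeX ℚ ⊗ₜ[ℚ] 1)
    (hf4 : f (0, LeeX ℚ) = -((1 : LeeAlg ℚ) ⊗ₜ[ℚ] (1 : LeeAlg ℚ)) + LeeX ℚ ⊗ₜ[ℚ] LeeX ℚ) :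
    Function.Bijective f ∧
    Nonempty (LeeAlg ℚ ≃ₗ[ℚ] ℚ × ℚ) ∧
    LinearMap.ker f = ⊥ ∧
    LinearMap.range f = ⊤ := by
  obtain ⟨b, hb0, hb1⟩ := exists_leeAlg_basis ℚ
  have : Module.Finite ℚ (LeeAlg ℚ) := .of_basis b
  have : Module.Free ℚ (LeeAlg ℚ) := .of_basis b
  have hA : Module.finrank ℚ (LeeAlg ℚ) = 2 := by simpa using Module.finrank_eq_card_basis b
  have hrange : LinearMap.range f = ⊤ := by
    rw [eq_top_iff, ← (b.tensorProduct b).span_eq, Submodule.span_le]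
    rintro _ ⟨⟨i, j⟩, rfl⟩
    rw [Module.Basis.tensorProduct_apply, SetLike.mem_coe]
    fin_cases i <;> fin_cases j <;> simp only [Fin.zero_eta, Fin.mk_one, hb0, hb1]
    · refine ⟨(2⁻¹ : ℚ) • ((LeeX ℚ, 0) - (0, LeeX ℚ)), ?_⟩
      rw [map_smul, map_sub, hf2, hf4]
      module
    · refine ⟨(-2⁻¹ : ℚ) • ((1, 0) + (0, 1)), ?_⟩
      rw [map_smul, map_add, hf1, hf3]
      module
    · refine ⟨(2⁻¹ : ℚ) • ((0, 1) - (1, 0)), ?_⟩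
      rw [map_smul, map_sub, hf1, hf3]
      module
    · refine ⟨(2⁻¹ : ℚ) • ((LeeX ℚ, 0) + (0, LeeX ℚ)), ?_⟩
      rw [map_smul, map_add, hf2, hf4]
      module
  have hsurj : Function.Surjective f := LinearMap.range_eq_top.mp hrange
  have hinj : Function.Injective f :=
    (LinearMap.injective_iff_surjective_of_finrank_eq_finrank
      (by rw [Module.finrank_prod, Module.finrank_tensorProduct, hA])).mpr hsurj
  exact ⟨⟨hinj, hsurj⟩, ⟨LinearEquiv.ofFinrankEq _ _ (by simp [hA])⟩,
    LinearMap.ker_eq_bot.mpr hinj, hrange⟩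

end
end
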